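/- Let $k \geq 1$ and let $m = (m_1,\dots,m_k) \in \mathbb{Z}^k$ with all $m_i > 0$ and $\gcd(m_1,\dots,m_k) = 1$, and set $H = \{t \in (\mathbb{C}^{\times})^{k} : \prod_i t_i^{m_i} = 1\}$ acting on $R = \mathbb{C}[x_1,\dots,x_k,\xi_1,\dots,\xi_k]$ by $x_i \mapsto t_i x_i$, $\xi_i \mapsto t_i^{-1}\xi_i$. Let $I \subseteq R$ be the ideal generated by the polynomials $m_j x_i \xi_i - m_i x_j \xi_j$ for $1 \leq i, j \leq k$, and let $h = \sum_{i=1}^{k} x_i \xi_i$. Then for every $H$-invariant polynomial $p \in R$ there exists a polynomial $q$ in the $\mathbb{C}$-subalgebra of $R$ generated by $f(\vec{x}) = \prod_i x_i^{m_i}$, $f(\vec{\xi}) = \prod_i \xi_i^{m_i}$ and $h$, such that $p - q \in I$. -/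

import Mathlib

open MvPolynomial

/-- Rescaling the variables by `w` multiplies the coefficient at `d` by `∏ s, w s ^ d s`. -/
theorem MvPolynomial.coeff_aeval_C_mul_X {σ R : Type*} [Fintype σ] [CommSemiring R]
    (w : σ → R) (p : MvPolynomial σ R) (d : σ →₀ ℕ) :
    coeff d (aeval (fun s => C (w s) * X s : σ → MvPolynomial σ R) p)
      = (∏ s, w s ^ d s) * coeff d p := by
  classical
  induction p using MvPolynomial.induction_on' with
  | monomial e a =>
    have h : aeval (fun s => C (w s) * X s : σ → MvPolynomial σ R) (monomial e a)
        = C (∏ s, w s ^ e s) * monomial e a := by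
      rw [aeval_monomial, Finsupp.prod_fintype _ _ (by simp), monomial_eq,
        Finsupp.prod_fintype _ _ (by simp)]
      simp only [mul_pow, Finset.prod_mul_distrib, algebraMap_eq, map_prod, map_pow]
      ring
    rw [h, coeff_C_mul, coeff_monomial]
    split_ifs with hed
    · rw [hed]
    · simp
  | add p q hp hq => rw [map_add, coeff_add, coeff_add, hp, hq, mul_add]

/-- A weight orthogonal to every integer vector orthogonal to a vector `m` with coprime entries is
an integer multiple of `m`. -/
theorem exists_eq_mul_of_forall_sum_mul_eq_zero {ι : Type*} [Fintype ι] {m c : ι → ℤ}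
    (hgcd : Finset.univ.gcd m = 1)
    (h : ∀ s : ι → ℤ, ∑ i, s i * m i = 0 → ∑ i, s i * c i = 0) :
    ∃ n : ℤ, ∀ i, c i = n * m i := by
  classical
  obtain ⟨u, hu⟩ := Finset.gcd_eq_sum_mul Finset.univ m
  have hcross (i j : ι) : m j * c i = m i * c j := by
    have := h (Pi.single i (m j) - Pi.single j (m i))
      (by simp [sub_mul, Finset.sum_sub_distrib, Pi.single_apply, mul_comm (m j)])
    simpa [sub_mul, Finset.sum_sub_distrib, Pi.single_apply, sub_eq_zero] using this
  refine ⟨∑ j, u j * c j, fun i => ?_⟩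
  calc c i = (∑ j, m j * u j) * c i := by rw [← hu, hgcd, one_mul]
    _ = (∑ j, u j * c j) * m i := by
      rw [Finset.sum_mul, Finset.sum_mul]
      exact Finset.sum_congr rfl fun j _ => by linear_combination u j * hcross i j

/-- A character `t ↦ ∏ i, t i ^ c i` trivial on the subtorus `∏ i, t i ^ m i = 1`, where the entries
of `m` are coprime, is a power of `t ↦ ∏ i, t i ^ m i`. -/
theorem exists_eq_mul_of_character_trivial {ι : Type*} [Fintype ι] {m c : ι → ℤ}
    (hgcd : Finset.univ.gcd m = 1)
    (h : ∀ t : ι → ℂˣ, ∏ i, t i ^ m i = 1 → ∏ i, t i ^ c i = 1) :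
    ∃ n : ℤ, ∀ i, c i = n * m i := by
  refine exists_eq_mul_of_forall_sum_mul_eq_zero hgcd fun s hs => ?_
  let z : ℂˣ := Units.mk0 2 two_ne_zero
  have hz (e : ι → ℤ) : ∏ i, (z ^ s i) ^ e i = z ^ ∑ i, s i * e i := by
    simp only [← zpow_mul]
    exact (map_sum (zmultiplesHom (Additive ℂˣ) (Additive.ofMul z)) _ _).symm
  have hc := h (fun i => z ^ s i) (by rw [hz, hs, zpow_zero])
  rw [hz] at hc
  have hc' := congrArg (fun v : ℂˣ => ‖(v : ℂ)‖) hc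
  simp only [Units.val_zpow_eq_zpow_val, norm_zpow, Units.val_one, norm_one, z, Units.val_mk0,
    Complex.norm_ofNat] at hc'
  exact (zpow_eq_one_iff_right₀ (by norm_num) (by norm_num)).1 hc'

/-- The exponents of an invariant of the subtorus `∏ i, t i ^ m i = 1` differ by a multiple
of `m`. -/
theorem exists_sub_eq_mul_of_mem_support {ι : Type*} [Fintype ι] {m : ι → ℤ}
    (hgcd : Finset.univ.gcd m = 1) {p : MvPolynomial (ι ⊕ ι) ℂ}
    (hp : ∀ t : ι → ℂˣ, ∏ i, t i ^ m i = 1 →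
      aeval (Sum.elim
        (fun i => C ((t i : ℂ)) * X (Sum.inl i))
        (fun i => C (((t i)⁻¹ : ℂˣ) : ℂ) * X (Sum.inr i))) p = p)
    {d : ι ⊕ ι →₀ ℕ} (hd : d ∈ p.support) :
    ∃ n : ℤ, ∀ i, (d (Sum.inl i) : ℤ) - d (Sum.inr i) = n * m i := by
  refine exists_eq_mul_of_character_trivial hgcd fun t ht => ?_
  let w : ι ⊕ ι → ℂˣ := Sum.elim t fun i => (t i)⁻¹
  have hw : (Sum.elim (fun i => C ((t i : ℂ)) * X (Sum.inl i))
      (fun i => C (((t i)⁻¹ : ℂˣ) : ℂ) * X (Sum.inr i)) : ι ⊕ ι → MvPolynomial (ι ⊕ ι) ℂ)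
      = fun s => C (w s : ℂ) * X s := by
    funext s
    cases s <;> rfl
  have hcoeff := congrArg (coeff d) (hp t ht)
  rw [hw, coeff_aeval_C_mul_X] at hcoeff
  have hone : ∏ s, (w s : ℂ) ^ d s = 1 := mul_right_cancel₀ (mem_support_iff.1 hd)
    (hcoeff.trans (one_mul _).symm)
  have hunit : ∏ s, w s ^ d s = 1 := by
    ext
    simpa using hone
  simpa [w, Fintype.prod_sum_type, zpow_sub, Finset.prod_mul_distrib] using hunit

/-- A family whose members are proportional with positive weights `m` consists of multiples of its
sum. -/
theorem mem_of_sum_mem_of_proportional {ι A : Type*} [Fintype ι] [CommRing A] [Algebra ℂ A]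
    (S : Subalgebra ℂ A) {m : ι → ℤ} (hm : ∀ i, 0 < m i) {y : ι → A}
    (hy : ∀ i j, (m j : ℂ) • y i = (m i : ℂ) • y j) (hS : ∑ i, y i ∈ S) (i : ι) : y i ∈ S := by
  have hM : ((∑ j, m j : ℤ) : ℂ) ≠ 0 :=
    Int.cast_ne_zero.2 (Finset.sum_pos (fun j _ => hm j) ⟨i, Finset.mem_univ i⟩).ne'
  have hsum : ((∑ j, m j : ℤ) : ℂ) • y i = (m i : ℂ) • ∑ j, y j := by
    rw [Int.cast_sum, Finset.sum_smul, Finset.smul_sum]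
    exact Finset.sum_congr rfl fun j _ => hy i j
  rw [← inv_smul_smul₀ hM (y i), hsum]
  exact S.smul_mem (S.smul_mem hS _) _

/-- If `a - b = n * m` with `m` nonnegative, then `∏ i, x i ^ a i * ∏ i, y i ^ b i` is a product of
powers of the `x i * y i` and of one of `∏ i, x i ^ m i`, `∏ i, y i ^ m i`. -/
theorem prod_pow_mul_prod_pow_mem {ι A : Type*} [Fintype ι] [CommRing A] [Algebra ℂ A]
    (S : Subalgebra ℂ A) {m : ι → ℤ} (hm : ∀ i, 0 ≤ m i) {x y : ι → A}
    (hx : ∏ i, x i ^ (m i).toNat ∈ S) (hy : ∏ i, y i ^ (m i).toNat ∈ S)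
    (hxy : ∀ i, x i * y i ∈ S) {a b : ι → ℕ} {n : ℤ} (hab : ∀ i, (a i : ℤ) - b i = n * m i) :
    (∏ i, x i ^ a i) * ∏ i, y i ^ b i ∈ S := by
  lift m to ι → ℕ using hm
  simp only [Int.toNat_natCast] at hx hy
  obtain ⟨l, rfl | rfl⟩ := n.eq_nat_or_neg
  · have ha (i : ι) : a i = b i + m i * l := by
      zify
      linear_combination hab i
    have heq : (∏ i, x i ^ a i) * ∏ i, y i ^ b i
        = (∏ i, (x i * y i) ^ b i) * (∏ i, x i ^ m i) ^ l := by
      simp only [ha, pow_add, pow_mul, mul_pow, Finset.prod_mul_distrib, Finset.prod_pow]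
      ring
    rw [heq]
    exact S.mul_mem (S.prod_mem fun i _ => S.pow_mem (hxy i) _) (S.pow_mem hx _)
  · have hb (i : ι) : b i = a i + m i * l := by
      zify
      linear_combination -hab i
    have heq : (∏ i, x i ^ a i) * ∏ i, y i ^ b i
        = (∏ i, (x i * y i) ^ a i) * (∏ i, y i ^ m i) ^ l := by
      simp only [hb, pow_add, pow_mul, mul_pow, Finset.prod_mul_distrib, Finset.prod_pow]
      ring
    rw [heq]
    exact S.mul_mem (S.prod_mem fun i _ => S.pow_mem (hxy i) _) (S.pow_mem hy _)

/-- Part (2) of the Corollary following Lemma 6.1: modulo the ideal generated by the shell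
relations `m j * x_i ξ_i - m i * x_j ξ_j`, every invariant of the subtorus
`H = {t : ∏ i, t i ^ m i = 1}` is congruent to an element of the subalgebra generated by
`f(x) = ∏ i, x_i ^ m_i`, `f(ξ) = ∏ i, ξ_i ^ m_i` and `h = ∑ i, x_i ξ_i`. -/
theorem stmt_9 (k : ℕ) (hk : 1 ≤ k) (m : Fin k → ℤ)
    (hm : ∀ i, 0 < m i) (hgcd : Finset.univ.gcd m = 1)
    (p : MvPolynomial (Fin k ⊕ Fin k) ℂ)
    (hp : ∀ t : Fin k → ℂˣ, ∏ i, t i ^ m i = 1 →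
      aeval (Sum.elim
        (fun i => C ((t i : ℂ)) * X (Sum.inl i))
        (fun i => C (((t i)⁻¹ : ℂˣ) : ℂ) * X (Sum.inr i))) p = p) :
    ∃ q ∈ Algebra.adjoin ℂ
      (insert (∏ i, X (Sum.inl i) ^ (m i).toNat
        : MvPolynomial (Fin k ⊕ Fin k) ℂ)
      (insert (∏ i, X (Sum.inr i) ^ (m i).toNat)
        {∑ i, X (Sum.inl i) * X (Sum.inr i)})),
      p - q ∈ Ideal.span (Set.range (fun ij : Fin k × Fin k =>
        (C (m ij.2 : ℂ) * (X (Sum.inl ij.1) * X (Sum.inr ij.1))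
          - C (m ij.1 : ℂ) * (X (Sum.inl ij.2) * X (Sum.inr ij.2))
          : MvPolynomial (Fin k ⊕ Fin k) ℂ))) := by
  set G : Set (MvPolynomial (Fin k ⊕ Fin k) ℂ) := insert (∏ i, X (Sum.inl i) ^ (m i).toNat)
    (insert (∏ i, X (Sum.inr i) ^ (m i).toNat) {∑ i, X (Sum.inl i) * X (Sum.inr i)}) with hG
  set I := Ideal.span (Set.range (fun ij : Fin k × Fin k =>
        (C (m ij.2 : ℂ) * (X (Sum.inl ij.1) * X (Sum.inr ij.1))
          - C (m ij.1 : ℂ) * (X (Sum.inl ij.2) * X (Sum.inr ij.2))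
          : MvPolynomial (Fin k ⊕ Fin k) ℂ)))
  let π := Ideal.Quotient.mkₐ ℂ I
  let S := (Algebra.adjoin ℂ G).map π
  have hgen {g} (hg : g ∈ G) : π g ∈ S := ⟨g, Algebra.subset_adjoin hg, rfl⟩
  have hx : ∏ i, π (X (Sum.inl i)) ^ (m i).toNat ∈ S := by
    simpa using hgen (g := ∏ i, X (Sum.inl i) ^ (m i).toNat) (by simp [hG])
  have hξ : ∏ i, π (X (Sum.inr i)) ^ (m i).toNat ∈ S := by
    simpa using hgen (g := ∏ i, X (Sum.inr i) ^ (m i).toNat) (by simp [hG])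
  have hh : ∑ i, π (X (Sum.inl i)) * π (X (Sum.inr i)) ∈ S := by
    simp_rw [← map_mul, ← map_sum]
    exact hgen (by simp [hG])
  have hxξ := mem_of_sum_mem_of_proportional S hm (fun i j => by
    rw [← map_mul, ← map_mul, ← map_smul, ← map_smul, smul_eq_C_mul, smul_eq_C_mul]
    exact Ideal.Quotient.eq.2 (Ideal.subset_span ⟨(i, j), rfl⟩)) hh
  have hpS : π p ∈ S := by
    rw [p.as_sum, map_sum]
    refine S.sum_mem fun d hd => ?_
    obtain ⟨n, hn⟩ := exists_sub_eq_mul_of_mem_support hgcd hp hd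
    rw [monomial_eq, Finsupp.prod_fintype _ _ (by simp), Fintype.prod_sum_type,
      ← smul_eq_C_mul, map_smul, map_mul, map_prod, map_prod]
    simp only [map_pow]
    exact S.smul_mem (prod_pow_mul_prod_pow_mem S (fun i => (hm i).le) hx hξ hxξ hn) _
  obtain ⟨q, hq, hqp⟩ := hpS
  exact ⟨q, hq, Ideal.Quotient.eq.1 hqp.symm⟩
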